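/- arXiv:2506.18884 — 3 statements merged into one kernel-verified Lean document; each statement's English description precedes it below -/
import Mathlib

section
/- Let Ω, Ω* be compact metric spaces and c : Ω × Ω* → ℝ continuous. For finite positive Borel measures η on Ω and τ on Ω*, let 𝒯_c(η, τ) ∈ ℝ ∪ {+∞} be the optimal transport cost: the infimum of ∫_{Ω×Ω*} c dπ over finite positive Borel measures π on Ω × Ω* whose first marginal is η and second marginal is τ, with 𝒯_c(η, τ) = +∞ if no such π exists. Then 𝒯_c is jointly substitutable in the following sense: for all finite positive Borel measures μ₁, μ₂ on Ω and ν₁, ν₂ on Ω*, for every finite measure a with a ≤ μ₂ − μ₁ (truncated measure subtraction, i.e. a ∈ [0, (μ₂ − μ₁)⁺]) and every finite measure b with b ≤ ν₁ − ν₂, there exist finite measures a' ≤ μ₁ − μ₂ and b' ≤ ν₂ − ν₁ such that 𝒯_c(μ₁ + a − a', ν₁ − b + b') + 𝒯_c(μ₂ − a + a', ν₂ + b − b') ≤ 𝒯_c(μ₁, ν₁) + 𝒯_c(μ₂, ν₂) in ℝ ∪ {+∞}. -/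
open MeasureTheory

namespace MeasureTheory.Measure

variable {X Y : Type*} [MeasurableSpace X] [MeasurableSpace Y]

protected lemma eq_of_add_eq_add_right {μ ν ξ : Measure X} [IsFiniteMeasure ξ]
    (h : μ + ξ = ν + ξ) : μ = ν := by
  rw [← Measure.add_sub_cancel (μ := μ) (ν := ξ), h, Measure.add_sub_cancel]

lemma le_sub_add_self (μ ν : Measure X) [IsFiniteMeasure μ] [IsFiniteMeasure ν] :
    μ ≤ μ - ν + ν :=
  Measure.sub_le_iff_le_add.1 le_rfl

lemma sub_sub_le (μ ν : Measure X) [IsFiniteMeasure μ] [IsFiniteMeasure ν] :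
    μ - (μ - ν) ≤ ν := by
  refine sub_le_of_le_add ?_
  rw [add_comm]
  exact le_sub_add_self μ ν

lemma sub_add_sub_sub_le (μ ν : Measure X) [IsFiniteMeasure μ] [IsFiniteMeasure ν] :
    ν - μ + (μ - (μ - ν)) ≤ ν := by
  have h := sub_sub_le μ ν
  have hle : ν - μ ≤ ν - (μ - (μ - ν)) := by
    refine sub_le_of_le_add ?_
    calc ν = ν - (μ - (μ - ν)) + (μ - (μ - ν)) := (sub_add_cancel_of_le h).symm
      _ ≤ _ := by gcongr; exact sub_le
  calc ν - μ + (μ - (μ - ν)) ≤ ν - (μ - (μ - ν)) + (μ - (μ - ν)) := by gcongr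
    _ = ν := sub_add_cancel_of_le h

lemma rnDeriv_mono_of_le {α β ν : Measure X} [IsFiniteMeasure ν] (hαβ : α ≤ β) (hβ : β ≤ ν) :
    α.rnDeriv ν ≤ᵐ[ν] β.rnDeriv ν := by
  have : IsFiniteMeasure β := isFiniteMeasure_of_le ν hβ
  have : IsFiniteMeasure α := isFiniteMeasure_of_le β hαβ
  have h := rnDeriv_add (β - α) α ν
  rw [sub_add_cancel_of_le hαβ] at h
  filter_upwards [h] with x hx
  rw [hx]
  exact le_add_self

lemma map_withDensity_comp (π : Measure X) {f : X → Y} (hf : Measurable f) {g : Y → ENNReal}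
    (hg : Measurable g) :
    (π.withDensity (g ∘ f)).map f = (π.map f).withDensity g := by
  ext s hs
  rw [map_apply hf hs, withDensity_apply _ (hf hs), withDensity_apply _ hs,
    setLIntegral_map hs hg hf]
  rfl

/-- Given a finite measure `π` on `X × Y` and a finite measure `ν` on `X`, one can select, for each
`β ≤ π.snd`, a part `R β ≤ π` with second marginal `β`, and split its first marginal into
`K β + D β`, where `K β` lies below the common part of `π.fst` and `ν`, `D β` lies below
`π.fst - ν`, and `K` is monotone. -/
lemma exists_monotone_splitting (π : Measure (X × Y)) [IsFiniteMeasure π]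
    (ν : Measure X) [IsFiniteMeasure ν] :
    ∃ (R : Measure Y → Measure (X × Y)) (K D : Measure Y → Measure X), Monotone K ∧
      (∀ β, K β ≤ π.fst - (π.fst - ν)) ∧ (∀ β, D β ≤ π.fst - ν) ∧ (∀ β, R β ≤ π) ∧
      (∀ β ≤ π.snd, (R β).snd = β) ∧ ∀ β, (R β).fst = K β + D β := by
  let h : X → ENNReal := (π.fst - ν).rnDeriv π.fst
  let g : X → ENNReal := (π.fst - (π.fst - ν)).rnDeriv π.fst
  let v : Measure Y → Y → ENNReal := fun β ↦ (β ⊓ π.snd).rnDeriv π.snd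
  have hh : Measurable h := measurable_rnDeriv _ _
  have hg : Measurable g := measurable_rnDeriv _ _
  have hv (β) : Measurable (v β) := measurable_rnDeriv _ _
  have hv_one (β) : ∀ᵐ p ∂π, v β p.2 ≤ 1 :=
    ae_of_ae_map measurable_snd.aemeasurable (rnDeriv_le_one_of_le (inf_le_right (a := β)))
  have hv_mono {β β' : Measure Y} (hβ : β ≤ β') : ∀ᵐ p ∂π, v β p.2 ≤ v β' p.2 :=
    ae_of_ae_map measurable_snd.aemeasurable
      (rnDeriv_mono_of_le (inf_le_inf_right _ hβ) inf_le_right)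
  have hgh : ∀ᵐ p ∂π, g p.1 + h p.1 = 1 := by
    refine ae_of_ae_map (p := fun x ↦ g x + h x = 1) measurable_fst.aemeasurable ?_
    have hadd := rnDeriv_add (π.fst - (π.fst - ν)) (π.fst - ν) π.fst
    rw [sub_add_cancel_of_le sub_le] at hadd
    filter_upwards [hadd, rnDeriv_self π.fst] with x hx hx'
    rw [← hx', hx]
    rfl
  have hle {f : X → ENNReal} (hf : Measurable f) (β) :
      (π.withDensity fun p ↦ f p.1 * v β p.2).fst ≤ π.fst.withDensity f := by
    rw [Measure.fst, Measure.fst, ← map_withDensity_comp π measurable_fst hf]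
    refine map_mono (withDensity_mono ?_) measurable_fst
    filter_upwards [hv_one β] with p hp
    exact mul_le_of_le_one_right' hp
  refine ⟨fun β ↦ π.withDensity fun p ↦ v β p.2,
    fun β ↦ (π.withDensity fun p ↦ g p.1 * v β p.2).fst,
    fun β ↦ (π.withDensity fun p ↦ h p.1 * v β p.2).fst, ?_, ?_, ?_, ?_, ?_, ?_⟩
  · intro β β' hβ
    refine map_mono (withDensity_mono ?_) measurable_fst
    filter_upwards [hv_mono hβ] with p hp
    exact mul_le_mul_right hp _
  · intro β
    refine (hle hg β).trans_eq (withDensity_rnDeriv_eq _ _ ?_)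
    exact absolutelyContinuous_of_le sub_le
  · intro β
    refine (hle hh β).trans_eq (withDensity_rnDeriv_eq _ _ ?_)
    exact absolutelyContinuous_of_le sub_le
  · intro β
    calc π.withDensity (fun p ↦ v β p.2) ≤ π.withDensity 1 := withDensity_mono (hv_one β)
      _ = π := withDensity_one
  · intro β hβ
    have hfin : IsFiniteMeasure β := isFiniteMeasure_of_le _ hβ
    have := map_withDensity_comp π measurable_snd (hv β)
    refine this.trans ?_
    simp only [v, inf_eq_left.2 hβ]
    exact withDensity_rnDeriv_eq _ _ (absolutelyContinuous_of_le hβ)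
  · intro β
    have hm : Measurable fun p : X × Y ↦ g p.1 * v β p.2 := by fun_prop
    simp only [Measure.fst]
    rw [← Measure.map_add _ _ measurable_fst, ← withDensity_add_left hm]
    congr 1
    refine withDensity_congr_ae ?_
    filter_upwards [hgh] with p hp
    simp only [Pi.add_apply]
    rw [← add_mul, hp, one_mul]

/-- Two finite measures `π₁`, `π₂` on a product space can exchange parts `ρ₁ ≤ π₁` and `ρ₂ ≤ π₂`
so that the first marginal of `π₁` gains a prescribed `a ≤ π₂.fst - π₁.fst`, its second marginal
loses a prescribed `b ≤ π₁.snd - π₂.snd`, and the remaining changes `a'`, `b'` of the marginals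
are at most `π₁.fst - π₂.fst` and `π₂.snd - π₁.snd`. -/
lemma exists_exchange (π₁ π₂ : Measure (X × Y)) [IsFiniteMeasure π₁] [IsFiniteMeasure π₂]
    {a : Measure X} (ha : a ≤ π₂.fst - π₁.fst) {b : Measure Y} (hb : b ≤ π₁.snd - π₂.snd) :
    ∃ (a' : Measure X) (b' : Measure Y) (ρ₁ ρ₂ : Measure (X × Y)),
      a' ≤ π₁.fst - π₂.fst ∧ b' ≤ π₂.snd - π₁.snd ∧ ρ₁ ≤ π₁ ∧ ρ₂ ≤ π₂ ∧
      ρ₂.fst + a' = ρ₁.fst + a ∧ ρ₁.snd + b' = ρ₂.snd + b := by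
  obtain ⟨R₁, K₁, D₁, K₁_mono, hK₁, hD₁, hR₁, hR₁snd, hR₁fst⟩ :=
    exists_monotone_splitting π₁ π₂.fst
  obtain ⟨R₂, K₂, D₂, K₂_mono, hK₂, hD₂, hR₂, hR₂snd, hR₂fst⟩ :=
    exists_monotone_splitting (π₂.map Prod.swap) π₁.snd
  simp only [fst_map_swap, snd_map_swap] at hK₂ hD₂ hR₂snd
  let F : Measure X →o Measure X :=
    ⟨fun α ↦ a + K₁ (b + K₂ α), fun _ _ h ↦
      add_le_add le_rfl (K₁_mono (add_le_add le_rfl (K₂_mono h)))⟩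
  set α := F.lfp
  have hα : a + K₁ (b + K₂ α) = α := F.map_lfp
  set β := b + K₂ α
  have hα_le : α ≤ π₂.fst := by
    rw [← hα]
    exact (add_le_add ha (hK₁ β)).trans (sub_add_sub_sub_le _ _)
  have hβ_le : β ≤ π₁.snd := (add_le_add hb (hK₂ α)).trans (sub_add_sub_sub_le _ _)
  refine ⟨D₁ β, D₂ α, R₁ β, (R₂ α).map Prod.swap, hD₁ β, hD₂ α, hR₁ β, ?_, ?_, ?_⟩
  · refine (map_mono (hR₂ α) measurable_swap).trans_eq ?_
    rw [map_map measurable_swap measurable_swap, Prod.swap_swap_eq, map_id]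
  · rw [fst_map_swap, hR₂snd α hα_le, hR₁fst, ← hα]
    abel
  · rw [snd_map_swap, hR₁snd β hβ_le, hR₂fst]
    simp only [β]
    abel

end MeasureTheory.Measure

section OptimalCoupling

variable {X Y : Type*} [TopologicalSpace X] [CompactSpace X] [MeasurableSpace X] [BorelSpace X]
  [TopologicalSpace Y] [CompactSpace Y] [MeasurableSpace Y] [BorelSpace Y]
  [T2Space X] [T2Space Y] [BorelSpace (X × Y)]

/-- On compact spaces, an optimal coupling for a continuous cost exists as soon as some coupling
does. -/
lemma exists_optimal_coupling [HasOuterApproxClosed X] [HasOuterApproxClosed Y]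
    {c : X × Y → ℝ} (hc : Continuous c) (π₀ : Measure (X × Y)) [IsFiniteMeasure π₀] :
    ∃ π : Measure (X × Y), π.fst = π₀.fst ∧ π.snd = π₀.snd ∧
      ∀ ρ : Measure (X × Y), ρ.fst = π₀.fst → ρ.snd = π₀.snd → ∫ p, c p ∂π ≤ ∫ p, c p ∂ρ := by
  let P₀ : FiniteMeasure (X × Y) := ⟨π₀, inferInstance⟩
  let S : Set (FiniteMeasure (X × Y)) :=
    {P | P.map Prod.fst = P₀.map Prod.fst} ∩ {P | P.map Prod.snd = P₀.map Prod.snd}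
  have hS_closed : IsClosed S :=
    (isClosed_eq (FiniteMeasure.continuous_map continuous_fst) continuous_const).inter
      (isClosed_eq (FiniteMeasure.continuous_map continuous_snd) continuous_const)
  have hmem {ρ : Measure (X × Y)} [hρ : IsFiniteMeasure ρ] (h₁ : ρ.fst = π₀.fst)
      (h₂ : ρ.snd = π₀.snd) : (⟨ρ, hρ⟩ : FiniteMeasure (X × Y)) ∈ S :=
    ⟨Subtype.ext h₁, Subtype.ext h₂⟩
  have hfst {P : FiniteMeasure (X × Y)} (hP : P ∈ S) : (P : Measure (X × Y)).fst = π₀.fst :=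
    congrArg Subtype.val hP.1
  have hsnd {P : FiniteMeasure (X × Y)} (hP : P ∈ S) : (P : Measure (X × Y)).snd = π₀.snd :=
    congrArg Subtype.val hP.2
  have hS_compact : IsCompact S := by
    refine (isCompact_setOfPred_finiteMeasure_eq_of_compactSpace (X × Y)
      P₀.mass).of_isClosed_subset hS_closed fun P hP ↦ ?_
    have h := congrArg (fun μ ↦ μ Set.univ) (hfst hP)
    simp only [Measure.fst_univ] at h
    exact congrArg ENNReal.toNNReal h
  obtain ⟨P, hP, hmin⟩ := hS_compact.exists_isMinOn ⟨P₀, hmem rfl rfl⟩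
    (FiniteMeasure.continuous_integral_continuousMap (⟨c, hc⟩ : C(X × Y, ℝ))).continuousOn
  refine ⟨P, hfst hP, hsnd hP, fun ρ h₁ h₂ ↦ ?_⟩
  have : IsFiniteMeasure ρ := by
    refine ⟨?_⟩
    rw [← Measure.fst_univ, h₁]
    exact measure_lt_top _ _
  exact hmin (hmem h₁ h₂)

end OptimalCoupling

/-- Joint substitutability of the optimal transport cost
`𝒯_c(η, τ) = inf { ∫ c dπ : π has marginals η, τ }` (valued in
`EReal`, with value `+∞` when no coupling exists). -/
theorem transportCost_jointly_substitutable
    {Ω Ωs : Type*} [MetricSpace Ω] [CompactSpace Ω]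
    [MeasurableSpace Ω] [BorelSpace Ω]
    [MetricSpace Ωs] [CompactSpace Ωs] [MeasurableSpace Ωs] [BorelSpace Ωs]
    (c : Ω × Ωs → ℝ) (hc : Continuous c)
    (Tc : Measure Ω → Measure Ωs → EReal)
    (hTc : ∀ (η : Measure Ω) (τ : Measure Ωs),
      Tc η τ = sInf {r : EReal | ∃ π : Measure (Ω × Ωs),
        π.map Prod.fst = η ∧ π.map Prod.snd = τ ∧
        r = ((∫ p, c p ∂π : ℝ) : EReal)}) :
    ∀ (μ₁ μ₂ : Measure Ω) (ν₁ ν₂ : Measure Ωs),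
      IsFiniteMeasure μ₁ → IsFiniteMeasure μ₂ →
      IsFiniteMeasure ν₁ → IsFiniteMeasure ν₂ →
      ∀ a : Measure Ω, a ≤ μ₂ - μ₁ → ∀ b : Measure Ωs, b ≤ ν₁ - ν₂ →
        ∃ (a' : Measure Ω) (b' : Measure Ωs), a' ≤ μ₁ - μ₂ ∧ b' ≤ ν₂ - ν₁ ∧
          Tc (μ₁ + a - a') (ν₁ - b + b') + Tc (μ₂ - a + a') (ν₂ + b - b') ≤
            Tc μ₁ ν₁ + Tc μ₂ ν₂ := by
  intro μ₁ μ₂ ν₁ ν₂ _ _ _ _ a ha b hb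
  have hc_int (π : Measure (Ω × Ωs)) [IsFiniteMeasure π] : Integrable c π :=
    (BoundedContinuousFunction.mkOfCompact ⟨c, hc⟩).integrable π
  have hTc_le (π : Measure (Ω × Ωs)) : Tc π.fst π.snd ≤ ((∫ p, c p ∂π : ℝ) : EReal) := by
    rw [hTc]
    exact sInf_le ⟨π, rfl, rfl, rfl⟩
  have hTc_opt (η : Measure Ω) (τ : Measure Ωs) [IsFiniteMeasure η] : Tc η τ = ⊤ ∨
      ∃ π : Measure (Ω × Ωs), IsFiniteMeasure π ∧ π.fst = η ∧ π.snd = τ ∧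
        Tc η τ = ((∫ p, c p ∂π : ℝ) : EReal) := by
    by_cases h : ∃ π : Measure (Ω × Ωs), π.fst = η ∧ π.snd = τ
    · right
      obtain ⟨π₀, rfl, rfl⟩ := h
      have fin_of {π : Measure (Ω × Ωs)} (h : π.fst = π₀.fst) : IsFiniteMeasure π := by
        refine ⟨?_⟩
        rw [← Measure.fst_univ, h]
        exact measure_lt_top _ _
      have := fin_of (π := π₀) rfl
      obtain ⟨π, h₁, h₂, hmin⟩ := exists_optimal_coupling hc π₀
      refine ⟨π, fin_of h₁, h₁, h₂, le_antisymm ?_ ?_⟩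
      · rw [← h₁, ← h₂]
        exact hTc_le π
      · rw [hTc]
        refine le_sInf ?_
        rintro _ ⟨ρ, hρ₁, hρ₂, rfl⟩
        exact EReal.coe_le_coe_iff.2 (hmin ρ hρ₁ hρ₂)
    · left
      rw [hTc, sInf_eq_top]
      rintro _ ⟨π, h₁, h₂, -⟩
      exact absurd ⟨π, h₁, h₂⟩ h
  have hTc_bot (η : Measure Ω) (τ : Measure Ωs) [IsFiniteMeasure η] : Tc η τ ≠ ⊥ := by
    rcases hTc_opt η τ with h | ⟨π, -, -, -, h⟩ <;> simp [h]
  rcases hTc_opt μ₁ ν₁ with h₁ | ⟨π₁, _, rfl, rfl, h₁⟩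
  · refine ⟨0, 0, Measure.zero_le _, Measure.zero_le _, ?_⟩
    rw [h₁, EReal.top_add_of_ne_bot (hTc_bot μ₂ ν₂)]
    exact le_top
  rcases hTc_opt μ₂ ν₂ with h₂ | ⟨π₂, _, rfl, rfl, h₂⟩
  · refine ⟨0, 0, Measure.zero_le _, Measure.zero_le _, ?_⟩
    rw [h₂, EReal.add_top_of_ne_bot (hTc_bot _ _)]
    exact le_top
  obtain ⟨a', b', ρ₁, ρ₂, ha', hb', hρ₁, hρ₂, hfst, hsnd⟩ := Measure.exists_exchange π₁ π₂ ha hb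
  refine ⟨a', b', ha', hb', ?_⟩
  have := isFiniteMeasure_of_le _ hρ₁
  have := isFiniteMeasure_of_le _ hρ₂
  have := isFiniteMeasure_of_le _ ha
  have := isFiniteMeasure_of_le _ hb
  have := isFiniteMeasure_of_le _ ha'
  have := isFiniteMeasure_of_le _ hb'
  have hπ₁ : π₁ - ρ₁ + ρ₁ = π₁ := Measure.sub_add_cancel_of_le hρ₁
  have hπ₂ : π₂ - ρ₂ + ρ₂ = π₂ := Measure.sub_add_cancel_of_le hρ₂
  have ha_sub : π₂.fst - a + a = π₂.fst :=
    Measure.sub_add_cancel_of_le (ha.trans Measure.sub_le)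
  have hb_sub : π₁.snd - b + b = π₁.snd :=
    Measure.sub_add_cancel_of_le (hb.trans Measure.sub_le)
  have hfst_add (π ρ : Measure (Ω × Ωs)) : (π + ρ).fst = π.fst + ρ.fst :=
    Measure.map_add _ _ measurable_fst
  have hsnd_add (π ρ : Measure (Ω × Ωs)) : (π + ρ).snd = π.snd + ρ.snd :=
    Measure.map_add _ _ measurable_snd
  have hfst₁ : π₁.fst + a - a' = (π₁ - ρ₁ + ρ₂).fst := by
    have : π₁.fst + a = (π₁ - ρ₁ + ρ₂).fst + a' := by
      nth_rw 1 [← hπ₁]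
      rw [hfst_add, hfst_add, add_assoc, add_assoc, hfst]
    rw [this, Measure.add_sub_cancel]
  have hsnd₁ : π₁.snd - b + b' = (π₁ - ρ₁ + ρ₂).snd := by
    refine Measure.eq_of_add_eq_add_right (ξ := b) ?_
    rw [add_right_comm, hb_sub]
    nth_rw 1 [← hπ₁]
    rw [hsnd_add, hsnd_add, add_assoc, add_assoc, hsnd]
  have hfst₂ : π₂.fst - a + a' = (π₂ - ρ₂ + ρ₁).fst := by
    refine Measure.eq_of_add_eq_add_right (ξ := a) ?_
    rw [add_right_comm, ha_sub]
    nth_rw 1 [← hπ₂]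
    rw [hfst_add, hfst_add, add_assoc, add_assoc, hfst]
  have hsnd₂ : π₂.snd + b - b' = (π₂ - ρ₂ + ρ₁).snd := by
    have : π₂.snd + b = (π₂ - ρ₂ + ρ₁).snd + b' := by
      nth_rw 1 [← hπ₂]
      rw [hsnd_add, hsnd_add, add_assoc, add_assoc, hsnd]
    rw [this, Measure.add_sub_cancel]
  rw [hfst₁, hsnd₁, hfst₂, hsnd₂, h₁, h₂]
  refine (add_le_add (hTc_le _) (hTc_le _)).trans_eq ?_
  rw [← EReal.coe_add, ← EReal.coe_add, EReal.coe_eq_coe_iff]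
  have hint₁ := integral_add_measure (hc_int (π₁ - ρ₁)) (hc_int ρ₁)
  have hint₂ := integral_add_measure (hc_int (π₂ - ρ₂)) (hc_int ρ₂)
  rw [hπ₁] at hint₁
  rw [hπ₂] at hint₂
  rw [hint₁, hint₂, integral_add_measure (hc_int _) (hc_int _),
    integral_add_measure (hc_int _) (hc_int _)]
  ring
end

section
/- Let Ω, Ω* be compact metric spaces and c : Ω × Ω* → ℝ continuous. For finite positive Borel measures μ on Ω and ν on Ω*, let 𝒯_c(μ, ν) ∈ ℝ ∪ {+∞} be the optimal transport cost (infimum of ∫ c dπ over couplings π of μ and ν, +∞ if none exists). Let m be a nonzero finite positive Borel measure on Ω*, let f : [0, ∞) → [0, ∞) be a finite-valued, strictly convex entropy function (convex, lower semicontinuous, with f(s)/s → ∞ as s → ∞), and let V : Ω* → ℝ be continuous. Define E(ν) = ∫_{Ω*} f((∂ν/∂m).toReal) dm + ∫_{Ω*} V dν if ν ≪ m, and E(ν) = +∞ otherwise. For i = 1, 2 let μᵢ be a finite positive Borel measure on Ω and suppose νᵢ is the unique minimizer over finite positive Borel measures ν on Ω* of ν ↦ 𝒯_c(μᵢ, ν)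 + E(ν). If μ₁(A) ≤ μ₂(A) for every Borel A ⊆ Ω, then ν₁(B) ≤ ν₂(B) for every Borel B ⊆ Ω*. -/
open MeasureTheory Filter
open scoped ENNReal

/-- A measure dominated by a pushforward is the pushforward of a dominated measure. -/
theorem exists_le_map_eq {X Y : Type*} [MeasurableSpace X] [MeasurableSpace Y] {g : X → Y}
    (hg : Measurable g) (π : Measure X) [IsFiniteMeasure π] {τ : Measure Y}
    (h : τ ≤ π.map g) : ∃ π' ≤ π, π'.map g = τ := by
  have : IsFiniteMeasure τ := isFiniteMeasure_of_le _ h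
  set d := τ.rnDeriv (π.map g) with hd
  have hdm : Measurable d := Measure.measurable_rnDeriv _ _
  have hd1 : d ≤ᵐ[π.map g] 1 := Measure.rnDeriv_le_one_of_le h
  refine ⟨π.withDensity (d ∘ g), ?_, ?_⟩
  · calc π.withDensity (d ∘ g) ≤ π.withDensity 1 :=
          withDensity_mono (ae_of_ae_map hg.aemeasurable hd1)
      _ = π := withDensity_one
  · ext B hB
    rw [Measure.map_apply hg hB, withDensity_apply _ (hg hB)]
    simp only [Function.comp_apply]
    rw [← setLIntegral_map hB hdm hg, ← withDensity_apply _ hB,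
      Measure.withDensity_rnDeriv_eq _ _ (Measure.absolutelyContinuous_of_le h)]

theorem rnDeriv_le_rnDeriv_of_le {X : Type*} [MeasurableSpace X] {p q m : Measure X}
    [IsFiniteMeasure q] [SigmaFinite m] (h : p ≤ q) (hq : q ≪ m) :
    p.rnDeriv m ≤ᵐ[m] q.rnDeriv m := by
  have : IsFiniteMeasure p := isFiniteMeasure_of_le _ h
  refine ae_le_of_forall_setLIntegral_le_of_sigmaFinite (Measure.measurable_rnDeriv _ _)
    fun s hs _ => ?_
  rw [Measure.setLIntegral_rnDeriv ((Measure.absolutelyContinuous_of_le h).trans hq),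
    Measure.setLIntegral_rnDeriv hq]
  exact h s

/-- A decreasing sequence of finite measures converges setwise to a measure. -/
theorem exists_tendsto_of_antitone {X : Type*} [MeasurableSpace X] (α : ℕ → Measure X)
    [IsFiniteMeasure (α 0)] (h : Antitone α) :
    ∃ α' : Measure X, ∀ A, MeasurableSet A → Tendsto (fun n => α n A) atTop (nhds (α' A)) := by
  have hfin : ∀ n, IsFiniteMeasure (α n) := fun n => isFiniteMeasure_of_le _ (h (Nat.zero_le n))
  have hdens : ∀ n, (α 0).withDensity ((α n).rnDeriv (α 0)) = α n := fun n =>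
    Measure.withDensity_rnDeriv_eq _ _ (Measure.absolutelyContinuous_of_le (h (Nat.zero_le n)))
  have hset : ∀ n A, MeasurableSet A → ∫⁻ x in A, (α n).rnDeriv (α 0) x ∂(α 0) = α n A := by
    intro n A hA
    rw [← withDensity_apply _ hA, hdens]
  refine ⟨(α 0).withDensity (fun x => ⨅ n, (α n).rnDeriv (α 0) x), fun A hA => ?_⟩
  have hmono : ∀ n, (α n.succ).rnDeriv (α 0) ≤ᵐ[α 0] (α n).rnDeriv (α 0) := by
    intro n
    exact rnDeriv_le_rnDeriv_of_le (h n.le_succ)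
      (Measure.absolutelyContinuous_of_le (h (Nat.zero_le n)))
  rw [withDensity_apply _ hA, lintegral_iInf_ae (fun n => Measure.measurable_rnDeriv _ _)
    (fun n => ae_restrict_of_ae (hmono n)) (by rw [hset _ _ hA]; exact measure_ne_top _ _)]
  simp_rw [hset _ _ hA]
  exact tendsto_atTop_iInf fun i j hij => h hij A

/-- Two finite measures have a common lower bound that is compatible with adding a measure. -/
theorem exists_le_le_and_le_add {X : Type*} [MeasurableSpace X] (p q : Measure X)
    [IsFiniteMeasure p] [IsFiniteMeasure q] :
    ∃ τ ≤ p, τ ≤ q ∧ ∀ r s : Measure X, r ≤ p + s → r ≤ q + s → r ≤ τ + s := by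
  obtain ⟨H, hH⟩ := exists_isHahnDecomposition p q
  have hm := hH.measurableSet
  refine ⟨p.restrict H + q.restrict Hᶜ, ?_, ?_, fun r s h₁ h₂ => ?_⟩
  · calc _ ≤ p.restrict H + p.restrict Hᶜ := by exact add_le_add le_rfl hH.ge_on_compl
      _ = p := Measure.restrict_add_restrict_compl hm
  · calc _ ≤ q.restrict H + q.restrict Hᶜ := by exact add_le_add hH.le_on le_rfl
      _ = q := Measure.restrict_add_restrict_compl hm
  · calc r = r.restrict H + r.restrict Hᶜ := (Measure.restrict_add_restrict_compl hm).symm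
      _ ≤ (p + s).restrict H + (q + s).restrict Hᶜ := by
          gcongr
      _ = p.restrict H + q.restrict Hᶜ + (s.restrict H + s.restrict Hᶜ) := by
          rw [Measure.restrict_add, Measure.restrict_add]; abel
      _ = _ := by rw [Measure.restrict_add_restrict_compl hm]

/-- One step of the alternating balancing scheme. -/
theorem exists_balancing_step {X Y : Type*} [MeasurableSpace X] [MeasurableSpace Y]
    {n₁ n₂ a : Measure Y} [IsFiniteMeasure a] (hn : n₁ ≤ n₂ + a)
    (α β : Measure (X × Y)) [IsFiniteMeasure α] [IsFiniteMeasure β]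
    (hx : α.map Prod.fst ≤ β.map Prod.fst)
    (hy : β.map Prod.snd + n₁ ≤ α.map Prod.snd + n₂) :
    ∃ α' ≤ α, ∃ β' ≤ β, α'.map Prod.fst ≤ β'.map Prod.fst ∧
      β'.map Prod.snd + n₁ ≤ α'.map Prod.snd + n₂ ∧
      α'.map Prod.snd ≤ β.map Prod.snd + a ∧ β'.map Prod.fst ≤ α.map Prod.fst := by
  obtain ⟨τ, hτ₁, hτ₂, hτ⟩ := exists_le_le_and_le_add (α.map Prod.snd) (β.map Prod.snd + a)
  obtain ⟨α', hα, rfl⟩ := exists_le_map_eq measurable_snd α hτ₁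
  obtain ⟨β', hβ, hβ'⟩ := exists_le_map_eq measurable_fst β hx
  have hβs : β'.map Prod.snd ≤ β.map Prod.snd := Measure.map_mono hβ measurable_snd
  refine ⟨α', hα, β', hβ, ?_, hτ _ _ ?_ ?_, hτ₂, hβ'.le⟩
  · rw [hβ']
    exact Measure.map_mono hα measurable_fst
  · exact (add_le_add_left hβs _).trans hy
  · calc β'.map Prod.snd + n₁ ≤ β.map Prod.snd + (n₂ + a) := add_le_add hβs hn
      _ = β.map Prod.snd + a + n₂ := by abel

/-- Exchange of mass between two transport plans whose first marginals are ordered: there are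
submeasures of the plans with the same first marginal, which correct the second marginals. -/
theorem exists_balanced_submeasures {X Y : Type*} [MeasurableSpace X] [MeasurableSpace Y]
    (π₁ π₂ : Measure (X × Y)) [IsFiniteMeasure π₁] [IsFiniteMeasure π₂]
    (a : Measure Y) [IsFiniteMeasure a]
    (hx : π₁.map Prod.fst ≤ π₂.map Prod.fst)
    (hy : π₁.map Prod.snd ≤ π₂.map Prod.snd + a) :
    ∃ α ≤ π₁, ∃ β ≤ π₂, α.map Prod.fst = β.map Prod.fst ∧
      β.map Prod.snd + π₁.map Prod.snd ≤ α.map Prod.snd + π₂.map Prod.snd ∧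
      α.map Prod.snd ≤ β.map Prod.snd + a := by
  let S := {p : Measure (X × Y) × Measure (X × Y) // p.1 ≤ π₁ ∧ p.2 ≤ π₂ ∧
    p.1.map Prod.fst ≤ p.2.map Prod.fst ∧
    p.2.map Prod.snd + π₁.map Prod.snd ≤ p.1.map Prod.snd + π₂.map Prod.snd}
  have hstep : ∀ p : S, ∃ p' : S, p'.1.1 ≤ p.1.1 ∧ p'.1.2 ≤ p.1.2 ∧
      p'.1.1.map Prod.snd ≤ p.1.2.map Prod.snd + a ∧
      p'.1.2.map Prod.fst ≤ p.1.1.map Prod.fst := by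
    rintro ⟨⟨α, β⟩, hα, hβ, h₁, h₂⟩
    have : IsFiniteMeasure α := isFiniteMeasure_of_le _ hα
    have : IsFiniteMeasure β := isFiniteMeasure_of_le _ hβ
    obtain ⟨α', hα', β', hβ', h₁', h₂', h₃, h₄⟩ := exists_balancing_step hy α β h₁ h₂
    exact ⟨⟨⟨α', β'⟩, hα'.trans hα, hβ'.trans hβ, h₁', h₂'⟩, hα', hβ', h₃, h₄⟩
  choose next hnext₁ hnext₂ hnext₃ hnext₄ using hstep
  let s : ℕ → S := fun n => next^[n] ⟨⟨π₁, π₂⟩, le_rfl, le_rfl, hx, (add_comm _ _).le⟩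
  have hs : ∀ n, s (n + 1) = next (s n) := fun n => Function.iterate_succ_apply' _ _ _
  have anti₁ : Antitone fun n => (s n).1.1 :=
    antitone_nat_of_succ_le fun n => by rw [hs]; exact hnext₁ _
  have anti₂ : Antitone fun n => (s n).1.2 :=
    antitone_nat_of_succ_le fun n => by rw [hs]; exact hnext₂ _
  have : IsFiniteMeasure (s 0).1.1 := isFiniteMeasure_of_le π₁ (s 0).2.1
  have : IsFiniteMeasure (s 0).1.2 := isFiniteMeasure_of_le π₂ (s 0).2.2.1
  obtain ⟨α, hα⟩ := exists_tendsto_of_antitone _ anti₁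
  obtain ⟨β, hβ⟩ := exists_tendsto_of_antitone _ anti₂
  have hαf : ∀ A, MeasurableSet A →
      Tendsto (fun n => (s n).1.1.map Prod.fst A) atTop (nhds (α.map Prod.fst A)) := by
    intro A hA
    simpa only [Measure.map_apply measurable_fst hA] using hα _ (measurable_fst hA)
  have hαs : ∀ A, MeasurableSet A →
      Tendsto (fun n => (s n).1.1.map Prod.snd A) atTop (nhds (α.map Prod.snd A)) := by
    intro A hA
    simpa only [Measure.map_apply measurable_snd hA] using hα _ (measurable_snd hA)
  have hβf : ∀ A, MeasurableSet A →
      Tendsto (fun n => (s n).1.2.map Prod.fst A) atTop (nhds (β.map Prod.fst A)) := by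
    intro A hA
    simpa only [Measure.map_apply measurable_fst hA] using hβ _ (measurable_fst hA)
  have hβs : ∀ A, MeasurableSet A →
      Tendsto (fun n => (s n).1.2.map Prod.snd A) atTop (nhds (β.map Prod.snd A)) := by
    intro A hA
    simpa only [Measure.map_apply measurable_snd hA] using hβ _ (measurable_snd hA)
  refine ⟨α, ?_, β, ?_, le_antisymm ?_ ?_, ?_, ?_⟩ <;> refine Measure.le_iff.2 fun A hA => ?_
  · exact le_of_tendsto' (hα A hA) fun n => (s n).2.1 A
  · exact le_of_tendsto' (hβ A hA) fun n => (s n).2.2.1 A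
  · exact le_of_tendsto_of_tendsto' (hαf A hA) (hβf A hA) fun n => (s n).2.2.2.1 A
  · refine le_of_tendsto_of_tendsto' ((tendsto_add_atTop_iff_nat 1).2 (hβf A hA)) (hαf A hA)
      fun n => ?_
    simp only [hs]
    exact hnext₄ (s n) A
  · simp only [Measure.add_apply]
    refine le_of_tendsto_of_tendsto' ((hβs A hA).add tendsto_const_nhds)
      ((hαs A hA).add tendsto_const_nhds) fun n => ?_
    exact (s n).2.2.2.2 A
  · simp only [Measure.add_apply]
    refine le_of_tendsto_of_tendsto' ((tendsto_add_atTop_iff_nat 1).2 (hαs A hA))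
      ((hβs A hA).add tendsto_const_nhds) fun n => ?_
    simp only [hs]
    exact hnext₃ (s n) A

theorem measure_le_of_add_le_add_left {X : Type*} [MeasurableSpace X] {p q r : Measure X}
    [IsFiniteMeasure p] (h : p + q ≤ p + r) : q ≤ r := by
  refine Measure.le_iff.2 fun A _ => ?_
  have := h A
  rw [Measure.add_apply, Measure.add_apply] at this
  exact (ENNReal.add_le_add_iff_left (measure_ne_top p A)).1 this

/-- Two plans with ordered first marginals can be rearranged, keeping their sum and their first
marginals, so that the second marginals become ordered as well. -/
theorem exists_ordered_rearrangement {X Y : Type*} [MeasurableSpace X] [MeasurableSpace Y]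
    (π₁ π₂ : Measure (X × Y)) [IsFiniteMeasure π₁] [IsFiniteMeasure π₂]
    (a : Measure Y) [IsFiniteMeasure a]
    (hx : π₁.map Prod.fst ≤ π₂.map Prod.fst)
    (hy : π₁.map Prod.snd ≤ π₂.map Prod.snd + a) :
    ∃ π₁' π₂' : Measure (X × Y), π₁' + π₂' = π₁ + π₂ ∧
      π₁'.map Prod.fst = π₁.map Prod.fst ∧ π₂'.map Prod.fst = π₂.map Prod.fst ∧
      π₁'.map Prod.snd ≤ π₂.map Prod.snd ∧ π₁.map Prod.snd ≤ π₁'.map Prod.snd + a := by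
  obtain ⟨α, hα, β, hβ, hfst, hs₁, hs₂⟩ := exists_balanced_submeasures π₁ π₂ a hx hy
  have : IsFiniteMeasure α := isFiniteMeasure_of_le _ hα
  have : IsFiniteMeasure β := isFiniteMeasure_of_le _ hβ
  have h₁ : π₁ - α + α = π₁ := Measure.sub_add_cancel_of_le hα
  have h₂ : π₂ - β + β = π₂ := Measure.sub_add_cancel_of_le hβ
  generalize π₁ - α = γ₁ at h₁
  generalize π₂ - β = γ₂ at h₂
  subst h₁ h₂
  simp only [Measure.map_add _ _ measurable_fst, Measure.map_add _ _ measurable_snd] at *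
  refine ⟨γ₁ + β, γ₂ + α, by abel, ?_, ?_, ?_, ?_⟩
  · rw [Measure.map_add _ _ measurable_fst, hfst]
  · rw [Measure.map_add _ _ measurable_fst, hfst]
  · rw [Measure.map_add _ _ measurable_snd]
    refine measure_le_of_add_le_add_left (p := α.map Prod.snd) ?_
    convert hs₁ using 1
    abel
  · rw [Measure.map_add _ _ measurable_snd, add_assoc]
    exact add_le_add le_rfl hs₂

/-- Existence of an optimal transport plan for a continuous cost on compact metric spaces. -/
theorem exists_optimal_plan {X Y : Type*} [MetricSpace X] [CompactSpace X]
    [MeasurableSpace X] [BorelSpace X]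
    [MetricSpace Y] [CompactSpace Y] [MeasurableSpace Y] [BorelSpace Y]
    {c : X × Y → ℝ} (hc : Continuous c) {η : Measure X} {τ : Measure Y} [IsFiniteMeasure η]
    {π₀ : Measure (X × Y)} (h₁ : π₀.map Prod.fst = η) (h₂ : π₀.map Prod.snd = τ) :
    ∃ π : Measure (X × Y), π.map Prod.fst = η ∧ π.map Prod.snd = τ ∧
      ∀ π' : Measure (X × Y), π'.map Prod.fst = η → π'.map Prod.snd = τ →
        ∫ p, c p ∂π ≤ ∫ p, c p ∂π' := by
  have hfin : ∀ π : Measure (X × Y), π.map Prod.fst = η → IsFiniteMeasure π := by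
    intro π h
    refine ⟨?_⟩
    have := measure_lt_top η Set.univ
    rwa [← h, Measure.map_apply measurable_fst MeasurableSet.univ, Set.preimage_univ] at this
  have := hfin π₀ h₁
  have : IsFiniteMeasure τ := by rw [← h₂]; infer_instance
  let P₀ : FiniteMeasure (X × Y) := ⟨π₀, inferInstance⟩
  let S : Set (FiniteMeasure (X × Y)) :=
    {π | π.mass = P₀.mass} ∩
      ({π | π.map Prod.fst = ⟨η, inferInstance⟩} ∩ {π | π.map Prod.snd = ⟨τ, inferInstance⟩})
  have hS : IsCompact S :=
    (isCompact_setOfPred_finiteMeasure_eq_of_compactSpace (X × Y) _).inter_right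
      ((isClosed_eq (FiniteMeasure.continuous_map continuous_fst) continuous_const).inter
        (isClosed_eq (FiniteMeasure.continuous_map continuous_snd) continuous_const))
  have mem_S : ∀ (π : Measure (X × Y)) (h : π.map Prod.fst = η) (_ : π.map Prod.snd = τ),
      (⟨π, hfin π h⟩ : FiniteMeasure (X × Y)) ∈ S := by
    intro π h h'
    refine ⟨?_, Subtype.ext h, Subtype.ext h'⟩
    have hu : π Set.univ = π₀ Set.univ := by
      have := congrArg (fun ξ => ξ Set.univ) (h.trans h₁.symm)
      simpa [Measure.map_apply measurable_fst MeasurableSet.univ] using this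
    exact congrArg ENNReal.toNNReal hu
  obtain ⟨π, hπ, hmin⟩ := hS.exists_isMinOn ⟨_, mem_S π₀ h₁ h₂⟩
    (FiniteMeasure.continuous_integral_continuousMap (⟨c, hc⟩ : C(X × Y, ℝ))).continuousOn
  exact ⟨π, congrArg Subtype.val hπ.2.1, congrArg Subtype.val hπ.2.2,
    fun π' h h' => hmin (mem_S π' h h')⟩

theorem ConvexOn.add_le_add_of_between {f : ℝ → ℝ} (hf : ConvexOn ℝ (Set.Ici 0) f)
    {r₁ r₂ s₁ s₂ : ℝ} (h₁ : 0 ≤ r₁) (h₂ : 0 ≤ r₂) (hsum : s₁ + s₂ = r₁ + r₂)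
    (hle : s₁ ≤ r₂) (hge : min r₁ r₂ ≤ s₁) : f s₁ + f s₂ ≤ f r₁ + f r₂ := by
  rcases le_or_gt r₂ r₁ with h | h
  · rw [min_eq_right h] at hge
    obtain rfl : s₁ = r₂ := le_antisymm hle hge
    obtain rfl : s₂ = r₁ := by linarith
    exact (add_comm _ _).le
  · rw [min_eq_left h.le] at hge
    have hd : 0 < r₂ - r₁ := sub_pos.2 h
    set t := (r₂ - s₁) / (r₂ - r₁) with ht
    have ht0 : 0 ≤ t := div_nonneg (by linarith) hd.le
    have ht1 : 0 ≤ 1 - t := by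
      rw [sub_nonneg, ht, div_le_one hd]; linarith
    have hts : t * (r₂ - r₁) = r₂ - s₁ := div_mul_cancel₀ _ hd.ne'
    have e₁ := hf.2 h₁ h₂ ht0 ht1 (by ring)
    have e₂ := hf.2 h₁ h₂ ht1 ht0 (by ring)
    simp only [smul_eq_mul] at e₁ e₂
    rw [show t * r₁ + (1 - t) * r₂ = s₁ by linarith] at e₁
    rw [show (1 - t) * r₁ + t * r₂ = s₂ by linarith] at e₂
    linarith

theorem ConvexOn.measurable_comp_toReal {f : ℝ → ℝ} (hf : ConvexOn ℝ (Set.Ici 0) f) :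
    Measurable fun x : ℝ≥0∞ => f x.toReal := by
  have hcont : ContinuousOn f (Set.Ioi 0) := by
    have := hf.continuousOn_interior
    rwa [interior_Ici] at this
  have hg : Measurable fun s : ℝ => f (max s 0) := by
    refine measurable_of_continuousOn_compl_singleton 0 fun s hs => ?_
    refine ContinuousAt.continuousWithinAt ?_
    rcases lt_or_gt_of_ne (show s ≠ 0 from hs) with h | h
    · refine (continuousAt_const (y := f 0)).congr ?_
      filter_upwards [eventually_lt_nhds h] with u hu
      rw [max_eq_right hu.le]
    · refine (hcont.continuousAt (Ioi_mem_nhds h)).congr ?_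
      filter_upwards [eventually_gt_nhds h] with u hu
      rw [max_eq_left hu.le]
  simpa [Function.comp_def] using hg.comp ENNReal.measurable_toReal

/-- The internal energy decreases under a rearrangement of densities towards each other. -/
theorem lintegral_energy_add_le {Y : Type*} [MeasurableSpace Y] {m : Measure Y}
    [IsFiniteMeasure m] {f : ℝ → ℝ} (hf : ConvexOn ℝ (Set.Ici 0) f)
    (hf0 : ∀ s, 0 ≤ s → 0 ≤ f s) {ν₁ ν₂ ν₁' ν₂' : Measure Y}
    [IsFiniteMeasure ν₁] [IsFiniteMeasure ν₂] [IsFiniteMeasure ν₁'] [IsFiniteMeasure ν₂']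
    (h₁ : ν₁ ≪ m) (h₂ : ν₂ ≪ m) (h₁' : ν₁' ≪ m)
    (hsum : ν₁' + ν₂' = ν₁ + ν₂) (hle : ν₁' ≤ ν₂)
    (hge : ν₁ ≤ ν₁' + m.withDensity (ν₁.rnDeriv m - ν₂.rnDeriv m)) :
    ∫⁻ y, ENNReal.ofReal (f ((ν₁'.rnDeriv m y).toReal)) ∂m +
        ∫⁻ y, ENNReal.ofReal (f ((ν₂'.rnDeriv m y).toReal)) ∂m ≤
      ∫⁻ y, ENNReal.ofReal (f ((ν₁.rnDeriv m y).toReal)) ∂m +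
        ∫⁻ y, ENNReal.ofReal (f ((ν₂.rnDeriv m y).toReal)) ∂m := by
  have hmeas : ∀ ν : Measure Y,
      Measurable fun y => ENNReal.ofReal (f ((ν.rnDeriv m y).toReal)) := fun ν =>
    (hf.measurable_comp_toReal.comp (Measure.measurable_rnDeriv ν m)).ennreal_ofReal
  have hdm : Measurable (ν₁.rnDeriv m - ν₂.rnDeriv m) :=
    (Measure.measurable_rnDeriv _ _).sub (Measure.measurable_rnDeriv _ _)
  have hda : m.withDensity (ν₁.rnDeriv m - ν₂.rnDeriv m) ≤ ν₁ := by
    conv_rhs => rw [← Measure.withDensity_rnDeriv_eq ν₁ m h₁]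
    exact withDensity_mono (Eventually.of_forall fun y => tsub_le_self)
  have : IsFiniteMeasure (m.withDensity (ν₁.rnDeriv m - ν₂.rnDeriv m)) :=
    isFiniteMeasure_of_le _ hda
  rw [← lintegral_add_left (hmeas _), ← lintegral_add_left (hmeas _)]
  refine lintegral_mono_ae ?_
  have hs' := Measure.rnDeriv_add ν₁' ν₂' m
  rw [hsum] at hs'
  filter_upwards [hs', Measure.rnDeriv_add ν₁ ν₂ m, rnDeriv_le_rnDeriv_of_le hle h₂,
    rnDeriv_le_rnDeriv_of_le hge (h₁'.add_left (withDensity_absolutelyContinuous _ _)),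
    Measure.rnDeriv_add ν₁' (m.withDensity (ν₁.rnDeriv m - ν₂.rnDeriv m)) m,
    Measure.rnDeriv_withDensity m hdm,
    Measure.rnDeriv_lt_top ν₁ m, Measure.rnDeriv_lt_top ν₂ m,
    Measure.rnDeriv_lt_top ν₁' m, Measure.rnDeriv_lt_top ν₂' m]
    with y e₁ e₂ e₃ e₄ e₅ e₆ t₁ t₂ t₁' t₂'
  rw [e₂] at e₁
  rw [e₅, Pi.add_apply, e₆] at e₄
  simp only [Pi.add_apply, Pi.sub_apply] at e₁ e₄
  generalize ν₁.rnDeriv m y = r₁ at *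
  generalize ν₂.rnDeriv m y = r₂ at *
  generalize ν₁'.rnDeriv m y = s₁ at *
  generalize ν₂'.rnDeriv m y = s₂ at *
  rw [← ENNReal.ofReal_add (hf0 _ ENNReal.toReal_nonneg) (hf0 _ ENNReal.toReal_nonneg),
    ← ENNReal.ofReal_add (hf0 _ ENNReal.toReal_nonneg) (hf0 _ ENNReal.toReal_nonneg)]
  refine ENNReal.ofReal_le_ofReal (hf.add_le_add_of_between ENNReal.toReal_nonneg
    ENNReal.toReal_nonneg ?_ (ENNReal.toReal_mono t₂.ne e₃) ?_)
  · rw [← ENNReal.toReal_add t₁'.ne t₂'.ne, ← ENNReal.toReal_add t₁.ne t₂.ne, e₁]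
  · rw [← ENNReal.toReal_min t₁.ne t₂.ne]
    refine ENNReal.toReal_mono t₁'.ne ?_
    rcases le_total r₁ r₂ with h | h
    · rw [tsub_eq_zero_of_le h, add_zero] at e₄
      exact (min_le_left _ _).trans e₄
    · refine (min_le_right _ _).trans ?_
      have : r₁ - r₂ + r₂ ≤ r₁ - r₂ + s₁ := by
        rwa [tsub_add_cancel_of_le h, add_comm]
      exact (ENNReal.add_le_add_iff_left (ne_top_of_le_ne_top t₁.ne tsub_le_self)).1 this

/-- Every finite measure can be transported to a multiple of `m`, which has finite internal
energy. -/
theorem exists_plan_finite_energy {X Y : Type*} [MeasurableSpace X] [MeasurableSpace Y]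
    (m : Measure Y) [IsFiniteMeasure m] (hm : m ≠ 0) (f : ℝ → ℝ) (μ : Measure X)
    [IsFiniteMeasure μ] :
    ∃ (π : Measure (X × Y)) (τ : Measure Y), IsFiniteMeasure τ ∧ π.map Prod.fst = μ ∧
      π.map Prod.snd = τ ∧ τ ≪ m ∧
      ∫⁻ y, ENNReal.ofReal (f ((τ.rnDeriv m y).toReal)) ∂m ≠ ⊤ := by
  have h0 : m Set.univ ≠ 0 := fun h => hm (Measure.measure_univ_eq_zero.1 h)
  have hi : (m Set.univ)⁻¹ ≠ ⊤ := ENNReal.inv_ne_top.2 h0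
  obtain ⟨t, ht⟩ : ∃ t, t = (m Set.univ)⁻¹ * μ Set.univ := ⟨_, rfl⟩
  have htop : t ≠ ⊤ := ht ▸ ENNReal.mul_ne_top hi (measure_ne_top _ _)
  refine ⟨(m Set.univ)⁻¹ • μ.prod m, t • m, m.smul_finite htop, ?_, ?_,
    Measure.smul_absolutelyContinuous, ?_⟩
  · rw [Measure.map_smul, Measure.map_fst_prod, smul_smul,
      ENNReal.inv_mul_cancel h0 (measure_ne_top _ _), one_smul]
  · rw [Measure.map_smul, Measure.map_snd_prod, smul_smul, ht]
  · have : ∫⁻ y, ENNReal.ofReal (f (((t • m).rnDeriv m y).toReal)) ∂m =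
        ∫⁻ _, ENNReal.ofReal (f t.toReal) ∂m := by
      refine lintegral_congr_ae ?_
      filter_upwards [Measure.rnDeriv_smul_left_of_ne_top m m htop, Measure.rnDeriv_self m]
        with y h₁ h₂
      rw [h₁, Pi.smul_apply, h₂, smul_eq_mul, mul_one]
    rw [this, lintegral_const]
    exact ENNReal.mul_ne_top ENNReal.ofReal_ne_top (measure_ne_top _ _)

/-- Comparison principle for JKO-type problems driven by the
standard optimal transport cost and a strictly convex internal energy plus a
potential energy. -/
theorem comparison_principle_JKO
    {Ω Ωs : Type*} [MetricSpace Ω] [CompactSpace Ω]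
    [MeasurableSpace Ω] [BorelSpace Ω]
    [MetricSpace Ωs] [CompactSpace Ωs] [MeasurableSpace Ωs] [BorelSpace Ωs]
    (c : Ω × Ωs → ℝ) (hc : Continuous c)
    (Tc : Measure Ω → Measure Ωs → EReal)
    (hTc : ∀ (η : Measure Ω) (τ : Measure Ωs),
      Tc η τ = sInf {r : EReal | ∃ π : Measure (Ω × Ωs),
        π.map Prod.fst = η ∧ π.map Prod.snd = τ ∧
        r = ((∫ p, c p ∂π : ℝ) : EReal)})
    (m : Measure Ωs) [IsFiniteMeasure m] (hm : m ≠ 0)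
    (f : ℝ → ℝ)
    (hf_nonneg : ∀ s : ℝ, 0 ≤ s → 0 ≤ f s)
    (hf_convex : ConvexOn ℝ (Set.Ici 0) f)
    (hf_strict : StrictConvexOn ℝ (Set.Ici 0) f)
    (hf_lsc : LowerSemicontinuousOn f (Set.Ici 0))
    (hf_superlinear : Tendsto (fun s : ℝ => f s / s) atTop atTop)
    (V : Ωs → ℝ) (hV : Continuous V)
    (E : Measure Ωs → EReal)
    (hE_ac : ∀ ν : Measure Ωs, ν ≪ m →
      E ν = ((∫⁻ y, ENNReal.ofReal (f ((ν.rnDeriv m y).toReal)) ∂m : ℝ≥0∞) : EReal) +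
        ((∫ y, V y ∂ν : ℝ) : EReal))
    (hE_sing : ∀ ν : Measure Ωs, ¬ ν ≪ m → E ν = ⊤)
    (μ₁ μ₂ : Measure Ω) [IsFiniteMeasure μ₁] [IsFiniteMeasure μ₂]
    (ν₁ ν₂ : Measure Ωs) [IsFiniteMeasure ν₁] [IsFiniteMeasure ν₂]
    (hmin₁ : ∀ ν : Measure Ωs, IsFiniteMeasure ν → Tc μ₁ ν₁ + E ν₁ ≤ Tc μ₁ ν + E ν)
    (hmin₂ : ∀ ν : Measure Ωs, IsFiniteMeasure ν → Tc μ₂ ν₂ + E ν₂ ≤ Tc μ₂ ν + E ν)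
    (huniq₁ : ∀ ν : Measure Ωs, IsFiniteMeasure ν →
      (∀ ν' : Measure Ωs, IsFiniteMeasure ν' → Tc μ₁ ν + E ν ≤ Tc μ₁ ν' + E ν') → ν = ν₁)
    (huniq₂ : ∀ ν : Measure Ωs, IsFiniteMeasure ν →
      (∀ ν' : Measure Ωs, IsFiniteMeasure ν' → Tc μ₂ ν + E ν ≤ Tc μ₂ ν' + E ν') → ν = ν₂)
    (hle : ∀ A : Set Ω, MeasurableSet A → μ₁ A ≤ μ₂ A) :
    ∀ B : Set Ωs, MeasurableSet B → ν₁ B ≤ ν₂ B := by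
  have hμ : μ₁ ≤ μ₂ := Measure.le_iff.2 hle
  suffices h : ν₁ ≤ ν₂ from fun B _ => h B
  set J : Measure Ωs → ℝ≥0∞ := fun ν =>
    ∫⁻ y, ENNReal.ofReal (f ((ν.rnDeriv m y).toReal)) ∂m with hJ
  have hTle : ∀ (π : Measure (Ω × Ωs)) (μ : Measure Ω) (ν : Measure Ωs),
      π.map Prod.fst = μ → π.map Prod.snd = ν → Tc μ ν ≤ ((∫ p, c p ∂π : ℝ) : EReal) := by
    intro π μ ν h₁ h₂
    rw [hTc]
    exact sInf_le ⟨π, h₁, h₂, rfl⟩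
  have hEreal : ∀ ν : Measure Ωs, ν ≪ m → J ν ≠ ⊤ →
      E ν = (((J ν).toReal + ∫ y, V y ∂ν : ℝ) : EReal) := by
    intro ν hν hJν
    rw [hE_ac ν hν, EReal.coe_add, EReal.coe_ennreal_toReal hJν]
  have hplan : ∀ (μ : Measure Ω) (ν : Measure Ωs), IsFiniteMeasure μ →
      (∀ ν' : Measure Ωs, IsFiniteMeasure ν' → Tc μ ν + E ν ≤ Tc μ ν' + E ν') →
      ∃ π : Measure (Ω × Ωs), IsFiniteMeasure π ∧ π.map Prod.fst = μ ∧ π.map Prod.snd = ν ∧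
        Tc μ ν = ((∫ p, c p ∂π : ℝ) : EReal) ∧ ν ≪ m ∧ J ν ≠ ⊤ := by
    intro μ ν _ hmin
    obtain ⟨π₀, τ, hτ, hπ₀f, hπ₀s, hτm, hJτ⟩ :=
      exists_plan_finite_energy (X := Ω) m hm f μ
    have hlt : Tc μ ν + E ν < ⊤ := by
      refine (hmin τ hτ).trans_lt (EReal.add_lt_top ?_ ?_)
      · exact ((hTle π₀ μ τ hπ₀f hπ₀s).trans_lt (EReal.coe_lt_top _)).ne
      · rw [hEreal τ hτm hJτ]
        exact EReal.coe_ne_top _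
    have hEbot : E ν ≠ ⊥ := by
      by_cases hν : ν ≪ m
      · rw [hE_ac ν hν, EReal.add_ne_bot_iff]
        exact ⟨EReal.coe_ennreal_ne_bot _, EReal.coe_ne_bot _⟩
      · rw [hE_sing ν hν]
        exact top_ne_bot
    by_cases hex : ∃ π : Measure (Ω × Ωs), π.map Prod.fst = μ ∧ π.map Prod.snd = ν
    · obtain ⟨π₁, h₁, h₂⟩ := hex
      obtain ⟨π, hπf, hπs, hopt⟩ := exists_optimal_plan hc h₁ h₂
      have hT : Tc μ ν = ((∫ p, c p ∂π : ℝ) : EReal) := by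
        refine le_antisymm (hTle π μ ν hπf hπs) ?_
        rw [hTc]
        refine le_sInf ?_
        rintro r ⟨π', h₁', h₂', rfl⟩
        exact EReal.coe_le_coe_iff.2 (hopt π' h₁' h₂')
      have hEtop : E ν ≠ ⊤ := by
        intro h
        rw [h, hT, EReal.coe_add_top] at hlt
        exact lt_irrefl _ hlt
      have hν : ν ≪ m := by
        by_contra h
        exact hEtop (hE_sing ν h)
      refine ⟨π, ?_, hπf, hπs, hT, hν, fun h => hEtop ?_⟩
      · refine ⟨?_⟩
        have := measure_lt_top μ Set.univ
        rwa [← hπf, Measure.map_apply measurable_fst MeasurableSet.univ, Set.preimage_univ] at this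
      · rw [hE_ac ν hν]
        change ((J ν : ℝ≥0∞) : EReal) + _ = ⊤
        rw [h, EReal.coe_ennreal_top, EReal.top_add_coe]
    · have hT : Tc μ ν = ⊤ := by
        rw [hTc, sInf_eq_top]
        rintro r ⟨π, h₁, h₂, -⟩
        exact absurd ⟨π, h₁, h₂⟩ hex
      rw [hT, EReal.top_add_of_ne_bot hEbot] at hlt
      exact absurd hlt (lt_irrefl _)
  obtain ⟨π₁, hπ₁, hf₁, hs₁, hT₁, hν₁, hJ₁⟩ := hplan μ₁ ν₁ inferInstance hmin₁
  obtain ⟨π₂, hπ₂, hf₂, hs₂, hT₂, hν₂, hJ₂⟩ := hplan μ₂ ν₂ inferInstance hmin₂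
  set a := m.withDensity (ν₁.rnDeriv m - ν₂.rnDeriv m) with ha
  have hdm : Measurable (ν₁.rnDeriv m - ν₂.rnDeriv m) :=
    (Measure.measurable_rnDeriv _ _).sub (Measure.measurable_rnDeriv _ _)
  have haν : a ≤ ν₁ := by
    conv_rhs => rw [← Measure.withDensity_rnDeriv_eq ν₁ m hν₁]
    exact withDensity_mono (Eventually.of_forall fun y => tsub_le_self)
  have : IsFiniteMeasure a := isFiniteMeasure_of_le _ haν
  have hνa : ν₁ ≤ ν₂ + a := by
    conv_lhs => rw [← Measure.withDensity_rnDeriv_eq ν₁ m hν₁]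
    conv_rhs => rw [← Measure.withDensity_rnDeriv_eq ν₂ m hν₂]
    rw [ha, ← withDensity_add_right _ hdm]
    exact withDensity_mono (Eventually.of_forall fun y => le_add_tsub)
  obtain ⟨π₁', π₂', hsum, hf₁', hf₂', hle', hge'⟩ := exists_ordered_rearrangement π₁ π₂ a
    (by rwa [hf₁, hf₂]) (by rwa [hs₁, hs₂])
  rw [hs₂] at hle'
  rw [hs₁] at hge'
  rw [hf₁] at hf₁'
  rw [hf₂] at hf₂'
  have : IsFiniteMeasure π₁' := isFiniteMeasure_of_le (π₁ + π₂) (hsum ▸ Measure.le_add_right le_rfl)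
  have : IsFiniteMeasure π₂' := isFiniteMeasure_of_le (π₁ + π₂) (hsum ▸ Measure.le_add_left le_rfl)
  obtain ⟨ν₁', hs₁'⟩ : ∃ ν, π₁'.map Prod.snd = ν := ⟨_, rfl⟩
  obtain ⟨ν₂', hs₂'⟩ : ∃ ν, π₂'.map Prod.snd = ν := ⟨_, rfl⟩
  have : IsFiniteMeasure ν₁' := by rw [← hs₁']; infer_instance
  have : IsFiniteMeasure ν₂' := by rw [← hs₂']; infer_instance
  rw [hs₁'] at hle' hge'
  have hνsum : ν₁' + ν₂' = ν₁ + ν₂ := by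
    rw [← hs₁, ← hs₂, ← hs₁', ← hs₂', ← Measure.map_add _ _ measurable_snd, hsum,
      Measure.map_add _ _ measurable_snd]
  have hac₁ : ν₁' ≪ m := (Measure.absolutelyContinuous_of_le hle').trans hν₂
  have hac₂ : ν₂' ≪ m :=
    (Measure.absolutelyContinuous_of_le (hνsum ▸ Measure.le_add_left le_rfl : ν₂' ≤ ν₁ + ν₂)).trans
      (hν₁.add_left hν₂)
  have hJle : J ν₁' + J ν₂' ≤ J ν₁ + J ν₂ :=
    lintegral_energy_add_le hf_convex hf_nonneg hν₁ hν₂ hac₁ hνsum hle' hge'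
  have hJtop : J ν₁' + J ν₂' ≠ ⊤ := ne_top_of_le_ne_top (ENNReal.add_ne_top.2 ⟨hJ₁, hJ₂⟩) hJle
  obtain ⟨hJ₁', hJ₂'⟩ := ENNReal.add_ne_top.1 hJtop
  have hJreal : (J ν₁').toReal + (J ν₂').toReal ≤ (J ν₁).toReal + (J ν₂).toReal := by
    rw [← ENNReal.toReal_add hJ₁' hJ₂', ← ENNReal.toReal_add hJ₁ hJ₂]
    exact ENNReal.toReal_mono (ENNReal.add_ne_top.2 ⟨hJ₁, hJ₂⟩) hJle
  have hVint : ∀ ν : Measure Ωs, IsFiniteMeasure ν → Integrable V ν := fun ν _ =>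
    hV.integrable_of_hasCompactSupport (HasCompactSupport.of_compactSpace V)
  have hcint : ∀ π : Measure (Ω × Ωs), IsFiniteMeasure π → Integrable c π := fun π _ =>
    hc.integrable_of_hasCompactSupport (HasCompactSupport.of_compactSpace c)
  have hVsum : ∫ y, V y ∂ν₁' + ∫ y, V y ∂ν₂' = ∫ y, V y ∂ν₁ + ∫ y, V y ∂ν₂ := by
    rw [← integral_add_measure (hVint _ ‹_›) (hVint _ ‹_›),
      ← integral_add_measure (hVint _ ‹_›) (hVint _ ‹_›), hνsum]
  have hcsum : ∫ p, c p ∂π₁' + ∫ p, c p ∂π₂' = ∫ p, c p ∂π₁ + ∫ p, c p ∂π₂ := by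
    rw [← integral_add_measure (hcint _ ‹_›) (hcint _ ‹_›),
      ← integral_add_measure (hcint _ ‹_›) (hcint _ ‹_›), hsum]
  have h₂ : ∫ p, c p ∂π₂ + ((J ν₂).toReal + ∫ y, V y ∂ν₂) ≤
      ∫ p, c p ∂π₂' + ((J ν₂').toReal + ∫ y, V y ∂ν₂') := by
    have := (hmin₂ ν₂' inferInstance).trans (add_le_add_left (hTle π₂' μ₂ ν₂' hf₂' hs₂') _)
    rw [hT₂, hEreal ν₂ hν₂ hJ₂, hEreal ν₂' hac₂ hJ₂'] at this
    exact_mod_cast this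
  have h₁ : Tc μ₁ ν₁' + E ν₁' ≤ Tc μ₁ ν₁ + E ν₁ := by
    refine (add_le_add_left (hTle π₁' μ₁ ν₁' hf₁' hs₁') _).trans ?_
    rw [hT₁, hEreal ν₁ hν₁ hJ₁, hEreal ν₁' hac₁ hJ₁', ← EReal.coe_add, ← EReal.coe_add,
      EReal.coe_le_coe_iff]
    linarith
  rw [← huniq₁ ν₁' inferInstance fun ν' hν' => h₁.trans (hmin₁ ν' hν')]
  exact hle'
end

section
/- Let n ≥ 1, let U be a nonempty bounded open subset of ℝⁿ (Euclidean space with the standard inner product), and let u₁, u₂ : ℝⁿ → ℝ be continuous on the closure of U and convex on the closure of U (ConvexOn ℝ (closure U) uᵢ). For a convex function u and a set E ⊆ closure U, define ∂u(E) = { y ∈ ℝⁿ : ∃ x ∈ E, ∀ z ∈ closure U, u(x) + ⟪y, z − x⟫ ≤ u(z) } (the image of E under the subdifferential of u relative to closure U). Suppose: (i) u₂(x) ≤ u₁(x) for every x in the topological boundary (frontier) of U; and (ii) for every Borel set E ⊆ U, the Lebesgue measure of ∂u₁(E) is at most the Lebesgue measure of ∂u₂(E). Then u₂(x) ≤ u₁(x)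 for every x ∈ U. -/
open MeasureTheory RealInnerProductSpace

section Lipschitz

open Measure Module

/-- If `a` is a Lipschitz function of `b` along `P`, with constant `K`, then the image of `P` under
`a` has volume at most `K ^ finrank ℝ E` times that of its image under `b`. -/
theorem volume_image_le_of_norm_sub_le {ι E : Type*} [NormedAddCommGroup E]
    [InnerProductSpace ℝ E] [FiniteDimensional ℝ E] [MeasurableSpace E] [BorelSpace E]
    (P : Set ι) (a b : ι → E) (K : NNReal)
    (h : ∀ i ∈ P, ∀ j ∈ P, ‖a i - a j‖ ≤ K * ‖b i - b j‖) :
    volume (a '' P) ≤ (K : ENNReal) ^ finrank ℝ E * volume (b '' P) := by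
  rcases P.eq_empty_or_nonempty with rfl | ⟨i₀, -⟩
  · simp
  have : Nonempty ι := ⟨i₀⟩
  set f : E → E := fun w => a (Function.invFunOn b P w)
  have hmem : ∀ i ∈ P, Function.invFunOn b P (b i) ∈ P := fun i hi =>
    Function.invFunOn_mem ⟨i, hi, rfl⟩
  have heq : ∀ i ∈ P, b (Function.invFunOn b P (b i)) = b i := fun i hi =>
    Function.invFunOn_eq ⟨i, hi, rfl⟩
  have hfb : ∀ i ∈ P, f (b i) = a i := by
    intro i hi
    have := h _ (hmem i hi) i hi
    rw [heq i hi, sub_self, norm_zero, mul_zero] at this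
    exact sub_eq_zero.1 (norm_le_zero_iff.1 this)
  have hL : LipschitzOnWith K f (b '' P) := by
    refine LipschitzOnWith.of_dist_le_mul ?_
    rintro _ ⟨i, hi, rfl⟩ _ ⟨j, hj, rfl⟩
    rw [hfb i hi, hfb j hj, dist_eq_norm, dist_eq_norm]
    exact h i hi j hj
  have himg : f '' (b '' P) = a '' P := by
    rw [Set.image_image]
    exact Set.image_congr hfb
  have hH := hL.hausdorffMeasure_image_le (d := (finrank ℝ E : ℝ)) (Nat.cast_nonneg _)
  rw [himg, ENNReal.rpow_natCast] at hH
  have hv := isAddLeftInvariant_eq_smul (volume : Measure E) (μH[(finrank ℝ E : ℝ)])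
  rw [hv]
  simp only [Measure.smul_apply]
  rw [mul_smul_comm]
  gcongr

end Lipschitz

section Subgradient

variable {E : Type*} [NormedAddCommGroup E] [InnerProductSpace ℝ E]

/-- A continuous convex function has a subgradient at every interior point of its domain. -/
theorem ConvexOn.exists_subgradient [CompleteSpace E] {C : Set E} {u : E → ℝ}
    (hu : ConvexOn ℝ C u) (hc : ContinuousOn u C) {x : E} (hx : x ∈ interior C) :
    ∃ y : E, ∀ z ∈ C, u x + ⟪y, z - x⟫ ≤ u z := by
  have hui : ConvexOn ℝ (interior C) u := hu.subset interior_subset hu.1.interior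
  have hA := hui.convex_strict_epigraph
  have hopen : IsOpen {p : E × ℝ | p.1 ∈ interior C ∧ u p.1 < p.2} := by
    have h1 : IsOpen (Prod.fst ⁻¹' interior C : Set (E × ℝ)) :=
      isOpen_interior.preimage continuous_fst
    have h2 : ContinuousOn (fun p : E × ℝ => p.2 - u p.1) (Prod.fst ⁻¹' interior C) :=
      continuousOn_snd.sub
        ((hc.mono interior_subset).comp continuousOn_fst fun p hp => hp)
    convert h2.isOpen_inter_preimage h1 isOpen_Ioi (t := Set.Ioi 0) using 1
    ext p
    simp
  obtain ⟨f, hf⟩ := geometric_hahn_banach_open_point hA hopen (x := (x, u x)) (by simp)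
  set s : ℝ := f (0, 1) with hs
  set g : StrongDual ℝ E := f.comp (ContinuousLinearMap.inl ℝ E ℝ) with hg
  have hdec : ∀ z t, f (z, t) = g z + t * s := by
    intro z t
    have : ((z, t) : E × ℝ) = (z, 0) + t • (0, 1) := by simp
    rw [this, map_add, map_smul]
    simp [hg, hs]
  have hs0 : s < 0 := by
    have := hf (x, u x + 1) ⟨hx, by simp⟩
    rw [hdec, hdec] at this
    linarith
  set y : E := (-s)⁻¹ • (InnerProductSpace.toDual ℝ E).symm g with hy
  have hyin : ∀ v, -s * ⟪y, v⟫ = g v := by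
    intro v
    rw [hy, real_inner_smul_left, InnerProductSpace.toDual_symm_apply]
    have := hs0.ne
    field_simp
  have hint : ∀ z ∈ interior C, u x + ⟪y, z - x⟫ ≤ u z := by
    intro z hz
    refine le_of_forall_gt_imp_ge_of_dense fun t ht => ?_
    have h1 := hf (z, t) ⟨hz, ht⟩
    rw [hdec, hdec] at h1
    have h2 := hyin (z - x)
    rw [map_sub] at h2
    nlinarith
  refine ⟨y, fun z hz => ?_⟩
  have hm := hu.1.combo_interior_self_mem_interior hx hz (a := 1 / 2) (b := 1 / 2)
    (by norm_num) (by norm_num) (by norm_num)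
  have h1 := hint _ hm
  have h2 := hu.2 (interior_subset hx) hz (by norm_num : (0 : ℝ) ≤ 1 / 2)
    (by norm_num : (0 : ℝ) ≤ 1 / 2) (by norm_num)
  have h3 : ((1 / 2 : ℝ) • x + (1 / 2 : ℝ) • z) - x = (1 / 2 : ℝ) • (z - x) := by module
  rw [h3, real_inner_smul_right] at h1
  simp only [smul_eq_mul] at h2
  linarith

/-- Subgradients at points lying at distance at least `r` from the complement of the domain are
bounded in terms of a bound for the function. -/
theorem norm_le_of_subgradient {C : Set E} {u : E → ℝ} {M r : ℝ} (hr : 0 < r)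
    (hM : ∀ z ∈ C, |u z| ≤ M) {x y : E} (hx : Metric.closedBall x r ⊆ C)
    (hy : ∀ z ∈ C, u x + ⟪y, z - x⟫ ≤ u z) : ‖y‖ ≤ 2 * M / r := by
  have hxC : x ∈ C := hx (Metric.mem_closedBall_self hr.le)
  have hM0 : 0 ≤ M := (abs_nonneg _).trans (hM x hxC)
  rcases eq_or_ne y 0 with rfl | hy0
  · simp only [norm_zero]; positivity
  have hn : 0 < ‖y‖ := norm_pos_iff.2 hy0
  have hz : x + (r / ‖y‖) • y ∈ C := by
    apply hx
    rw [Metric.mem_closedBall, dist_eq_norm, add_sub_cancel_left, norm_smul, Real.norm_eq_abs,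
      abs_of_pos (by positivity)]
    field_simp
    exact le_rfl
  have h1 := hy _ hz
  rw [add_sub_cancel_left, real_inner_smul_right, real_inner_self_eq_norm_sq] at h1
  have h2 : r / ‖y‖ * ‖y‖ ^ 2 = r * ‖y‖ := by field_simp
  have h3 := abs_le.1 (hM x hxC)
  have h4 := abs_le.1 (hM _ hz)
  rw [le_div_iff₀ hr]
  linarith

/-- Monotonicity of the subdifferential. -/
theorem inner_subgradient_sub_nonneg {C : Set E} {u : E → ℝ} {x x' y y' : E}
    (hx : x ∈ C) (hx' : x' ∈ C) (hy : ∀ z ∈ C, u x + ⟪y, z - x⟫ ≤ u z)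
    (hy' : ∀ z ∈ C, u x' + ⟪y', z - x'⟫ ≤ u z) : 0 ≤ ⟪y - y', x - x'⟫ := by
  have h1 := hy x' hx'
  have h2 := hy' x hx
  rw [← neg_sub x x', inner_neg_right] at h1
  rw [inner_sub_left]
  linarith

theorem norm_le_norm_add_of_inner_nonneg {a b : E} (h : 0 ≤ ⟪a, b⟫) : ‖a‖ ≤ ‖a + b‖ := by
  have := norm_add_sq_real a b
  refine abs_le_of_sq_le_sq' ?_ (norm_nonneg _) |>.2
  nlinarith [sq_nonneg ‖b‖]

/-- A slope supporting `v` at a point where `u < v` also supports `u`, at some point where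
`u < v`, provided that `v < u` off `U`. -/
theorem exists_subgradient_of_lt {C U : Set E} {u v : E → ℝ} (hC : IsCompact C)
    (hc : ContinuousOn u C) (hv : ∀ z ∈ C, z ∉ U → v z < u z) {x w : E} (hx : x ∈ C)
    (hux : u x < v x) (hw : ∀ z ∈ C, v x + ⟪w, z - x⟫ ≤ v z) :
    ∃ x' ∈ U, u x' < v x' ∧ ∀ z ∈ C, u x' + ⟪w, z - x'⟫ ≤ u z := by
  obtain ⟨x', hx', hmin⟩ := hC.exists_isMinOn ⟨x, hx⟩
    (hc.sub (continuous_const.inner continuous_id : Continuous fun z => ⟪w, z⟫).continuousOn)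
  have hmin' : ∀ z ∈ C, u x' - ⟪w, x'⟫ ≤ u z - ⟪w, z⟫ := fun z hz => hmin hz
  have hlt : u x' < v x' := by
    have h1 := hmin' x hx
    have h2 := hw x' hx'
    rw [inner_sub_right] at h2
    linarith
  refine ⟨x', ?_, hlt, fun z hz => ?_⟩
  · by_contra hxU
    exact (hv x' hx' hxU).not_gt hlt
  · have := hmin' z hz
    rw [inner_sub_right]
    linarith

end Subgradient

/-- Comparison principle for the Monge–Ampère equation: if
`u₂ ≤ u₁` on the boundary of `U` and the Monge–Ampère measure of `u₁` (the
Lebesgue measure of the image of sets under the subdifferential) is at most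
that of `u₂` on `U`, then `u₂ ≤ u₁` on `U`. -/
theorem comparison_principle_monge_ampere
    (n : ℕ) (hn : 1 ≤ n) (U : Set (EuclideanSpace ℝ (Fin n)))
    (hUopen : IsOpen U) (hUne : U.Nonempty) (hUbd : Bornology.IsBounded U)
    (u₁ u₂ : EuclideanSpace ℝ (Fin n) → ℝ)
    (hc₁ : ContinuousOn u₁ (closure U)) (hc₂ : ContinuousOn u₂ (closure U))
    (hv₁ : ConvexOn ℝ (closure U) u₁) (hv₂ : ConvexOn ℝ (closure U) u₂)
    (hbd : ∀ x ∈ frontier U, u₂ x ≤ u₁ x)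
    (hMA : ∀ E : Set (EuclideanSpace ℝ (Fin n)), E ⊆ U → MeasurableSet E →
      volume {y : EuclideanSpace ℝ (Fin n) |
          ∃ x ∈ E, ∀ z ∈ closure U, u₁ x + ⟪y, z - x⟫ ≤ u₁ z} ≤
        volume {y : EuclideanSpace ℝ (Fin n) |
          ∃ x ∈ E, ∀ z ∈ closure U, u₂ x + ⟪y, z - x⟫ ≤ u₂ z}) :
    ∀ x ∈ U, u₂ x ≤ u₁ x := by
  intro x₀ hx₀
  by_contra! hlt
  set C := closure U with hC
  have hUC : U ⊆ C := subset_closure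
  have hCc : IsCompact C := hUbd.isCompact_closure
  obtain ⟨M, hM⟩ := hCc.exists_bound_of_continuousOn
    (hc₂.add (continuous_const.mul (continuous_norm.pow 2) :
      Continuous fun z : EuclideanSpace ℝ (Fin n) => (1 / 2 : ℝ) * ‖z‖ ^ 2).continuousOn)
  obtain ⟨M₁, hM₁⟩ := hCc.exists_bound_of_continuousOn hc₁
  have hM0 : 0 ≤ M := (norm_nonneg _).trans (hM x₀ (hUC hx₀))
  obtain ⟨d, hd, hd4⟩ : ∃ d : ℝ, 0 < d ∧ 4 * d = u₂ x₀ - u₁ x₀ :=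
    ⟨(u₂ x₀ - u₁ x₀) / 4, by linarith, by ring⟩
  set t : ℝ := d / (M + 1) with ht
  have ht0 : 0 < t := by positivity
  have htM : t * M < d := by
    have : t * (M + 1) = d := by rw [ht]; field_simp
    linarith
  -- the perturbed competitor
  set v : EuclideanSpace ℝ (Fin n) → ℝ :=
    fun z => u₂ z + t * (u₂ z + 1 / 2 * ‖z‖ ^ 2) - 2 * d with hv
  have hpert : ∀ z ∈ C, |v z - (u₂ z - 2 * d)| < d := by
    intro z hz
    have h1 : |u₂ z + 1 / 2 * ‖z‖ ^ 2| ≤ M := hM z hz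
    have h2 : v z - (u₂ z - 2 * d) = t * (u₂ z + 1 / 2 * ‖z‖ ^ 2) := by rw [hv]; ring
    rw [h2, abs_mul, abs_of_pos ht0]
    exact (mul_le_mul_of_nonneg_left h1 ht0.le).trans_lt htM
  have hvc : ContinuousOn v C :=
    (hc₂.add (continuousOn_const.mul (hc₂.add
      (continuous_const.mul (continuous_norm.pow 2)).continuousOn))).sub continuousOn_const
  have hfr : ∀ z ∈ C, z ∉ U → v z < u₁ z := by
    intro z hz hzU
    have h1 := hbd z ⟨hz, by rwa [hUopen.interior_eq]⟩
    have h2 := abs_lt.1 (hpert z hz)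
    linarith
  set V := {x | x ∈ U ∧ u₁ x < v x} with hV
  have hVU : V ⊆ U := fun x hx => hx.1
  have hVopen : IsOpen V := by
    convert ((hvc.sub hc₁).mono hUC).isOpen_inter_preimage hUopen
      (isOpen_Ioi (a := (0 : ℝ))) using 1
    ext x
    simp [hV]
  have hx₀V : x₀ ∈ V := by
    refine ⟨hx₀, ?_⟩
    have h2 := abs_lt.1 (hpert x₀ (hUC hx₀))
    linarith
  have hmain := hMA V hVU hVopen.measurableSet
  set P : Set (EuclideanSpace ℝ (Fin n) × EuclideanSpace ℝ (Fin n)) :=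
    {p | p.1 ∈ V ∧ ∀ z ∈ C, u₂ p.1 + ⟪p.2, z - p.1⟫ ≤ u₂ z}
  set b : EuclideanSpace ℝ (Fin n) × EuclideanSpace ℝ (Fin n) → EuclideanSpace ℝ (Fin n) :=
    fun p => (1 + t) • p.2 + t • p.1 with hb
  have hmono : ∀ p ∈ P, ∀ q ∈ P, 0 ≤ ⟪(1 + t) • (p.2 - q.2), t • (p.1 - q.1)⟫ := by
    intro p hp q hq
    rw [real_inner_smul_left, real_inner_smul_right]
    have := inner_subgradient_sub_nonneg (hUC (hVU hp.1)) (hUC (hVU hq.1)) hp.2 hq.2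
    positivity
  have hbsub : ∀ p q, b p - b q = (1 + t) • (p.2 - q.2) + t • (p.1 - q.1) := by
    intro p q
    simp only [hb]
    module
  have hsnd : Prod.snd '' P = {y | ∃ x ∈ V, ∀ z ∈ C, u₂ x + ⟪y, z - x⟫ ≤ u₂ z} := by
    ext y
    constructor
    · rintro ⟨⟨x, y⟩, hp, rfl⟩
      exact ⟨x, hp.1, hp.2⟩
    · rintro ⟨x, hx, hy⟩
      exact ⟨(x, y), ⟨hx, hy⟩, rfl⟩
  have hfst : Prod.fst '' P = V := by
    ext x
    constructor
    · rintro ⟨p, hp, rfl⟩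
      exact hp.1
    · intro hx
      obtain ⟨y, hy⟩ := hv₂.exists_subgradient hc₂
        (interior_maximal hUC hUopen (hVU hx))
      exact ⟨(x, y), ⟨hx, hy⟩, rfl⟩
  have hvol₂ := volume_image_le_of_norm_sub_le P Prod.snd b (NNReal.mk (1 + t)⁻¹ (by positivity)) (by
    intro p hp q hq
    have h := norm_le_norm_add_of_inner_nonneg (hmono p hp q hq)
    rw [← hbsub, norm_smul, Real.norm_eq_abs, abs_of_pos (by positivity)] at h
    rw [NNReal.coe_mk, ← div_eq_inv_mul, le_div_iff₀ (by positivity)]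
    linarith)
  have hvolV := volume_image_le_of_norm_sub_le P Prod.fst b (NNReal.mk t⁻¹ (by positivity)) (by
    intro p hp q hq
    have h := norm_le_norm_add_of_inner_nonneg ((hmono p hp q hq).trans_eq (real_inner_comm _ _))
    rw [add_comm, ← hbsub, norm_smul, Real.norm_eq_abs, abs_of_pos (by positivity)] at h
    rw [NNReal.coe_mk, ← div_eq_inv_mul, le_div_iff₀ (by positivity)]
    linarith)
  rw [hsnd, finrank_euclideanSpace_fin] at hvol₂
  rw [hfst, finrank_euclideanSpace_fin] at hvolV
  -- slopes of the competitor on `V` are slopes of `u₁` on `V`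
  have hsub : b '' P ⊆ {y | ∃ x ∈ V, ∀ z ∈ C, u₁ x + ⟪y, z - x⟫ ≤ u₁ z} := by
    rintro _ ⟨⟨x, y⟩, ⟨hx, hy⟩, rfl⟩
    obtain ⟨x', hx'U, hx', h⟩ := exists_subgradient_of_lt (w := b (x, y)) hCc hc₁ hfr
      (hUC (hVU hx)) hx.2 (by
        intro z hz
        have h1 := hy z hz
        have h2 : 0 ≤ ‖z - x‖ ^ 2 := sq_nonneg _
        have h3 := norm_add_sq_real x (z - x)
        rw [add_sub_cancel] at h3
        simp only [hb, hv, inner_add_left, real_inner_smul_left]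
        simp only at h1
        nlinarith)
    exact ⟨x', ⟨hx'U, hx'⟩, h⟩
  have hfin : volume {y | ∃ x ∈ V, ∀ z ∈ C, u₁ x + ⟪y, z - x⟫ ≤ u₁ z} < ⊤ := by
    have hKc : IsCompact (C ∩ (fun z => v z - u₁ z) ⁻¹' Set.Ici 0) :=
      hCc.of_isClosed_subset
        ((hvc.sub hc₁).preimage_isClosed_of_isClosed hCc.isClosed isClosed_Ici)
        Set.inter_subset_left
    have hKU : C ∩ (fun z => v z - u₁ z) ⁻¹' Set.Ici 0 ⊆ U := by
      rintro z ⟨hz, hz0⟩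
      by_contra hzU
      have := hfr z hz hzU
      have h0 : 0 ≤ v z - u₁ z := hz0
      linarith
    obtain ⟨r, hr, hrU⟩ := hKc.exists_cthickening_subset_open hUopen hKU
    refine (Metric.isBounded_closedBall (x := 0) (r := 2 * M₁ / r)).subset ?_
      |>.measure_lt_top
    rintro y ⟨x, hx, hy⟩
    rw [mem_closedBall_zero_iff]
    refine norm_le_of_subgradient hr hM₁ ?_ hy
    refine (Metric.closedBall_subset_cthickening (E := C ∩ (fun z => v z - u₁ z) ⁻¹' Set.Ici 0)
      ⟨hUC (hVU hx), ?_⟩ r).trans (hrU.trans hUC)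
    exact (sub_pos.2 hx.2).le
  have hbtop : volume (b '' P) ≠ ⊤ := ((measure_mono hsub).trans_lt hfin).ne
  have hchain := (measure_mono hsub).trans (hmain.trans hvol₂)
  have hb0 : volume (b '' P) = 0 := by
    by_contra hne
    have hK : (NNReal.mk (1 + t)⁻¹ (by positivity) : ENNReal) ^ n < 1 := by
      refine pow_lt_one₀ zero_le ?_ (by lia)
      rw [ENNReal.coe_lt_one_iff, ← NNReal.coe_lt_coe]
      exact inv_lt_one_of_one_lt₀ (by linarith)
    have := ENNReal.mul_lt_mul_left hne hbtop hK
    rw [one_mul] at this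
    exact (this.trans_le hchain).false
  rw [hb0, mul_zero] at hvolV
  exact (hVopen.measure_pos volume ⟨x₀, hx₀V⟩).not_ge hvolV
end
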